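/- Let m be a square-free positive integer with m ≡ 2 (mod 4), let θ = m^(1/4), K = ℚ(i, θ), and let α be any element of the ring of integers O_K. Define, using the eight embeddings σ_{j,k} of K into ℂ (where σ_{j,k}(i) = (−1)^{j−1} i and σ_{j,k}(θ) = i^{k−1} θ for j ∈ {1,2}, k ∈ {1,2,3,4}), writing α^{(j,k)} = σ_{j,k}(α): S₁ = ∏_{j=1}^{2} (α^{(j,1)}−α^{(j,2)})(α^{(j,2)}−α^{(j,3)})(α^{(j,3)}−α^{(j,4)})(α^{(j,4)}−α^{(j,1)}), S₂ = ∏_{j=1}^{2} (α^{(j,1)}−α^{(j,3)})(α^{(j,2)}−α^{(j,4)}), S₃ = ∏_{k=1}^{4} (α^{(1,k)}−α^{(2,k)}), S₄ = (α^{(1,1)}−α^{(2,4)})(α^{(1,2)}−α^{(2,1)})(α^{(1,3)}−α^{(2,2)})(α^{(1,4)}−α^{(2,3)}), S₅ = (α^{(1,1)}−α^{(2,3)})(α^{(1,2)}−α^{(2,4)})(α^{(1,3)}−α^{(2,1)})(α^{(1,4)}−α^{(2,2)}), S₆ = (α^{(1,1)}−α^{(2,2)})(α^{(1,2)}−α^{(2,3)})(α^{(1,3)}−α^{(2,4)})(α^{(1,4)}−α^{(2,1)}).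 Then S₁, …, S₆ are rational integers, 4m² divides S₁, 8m divides S₂, and 2 divides each of S₃, S₄, S₅, S₆. -/

import Mathlib

open NumberField

/-- The real positive fourth root of `m`, viewed as a complex number. -/
noncomputable def theta (m : ℕ) : ℂ := ((m : ℝ) ^ ((1 : ℝ) / 4) : ℝ)

/-- The octic field `K = ℚ(i, m^(1/4))` as a subfield of `ℂ`. -/
noncomputable def Kfield (m : ℕ) : IntermediateField ℚ ℂ :=
  IntermediateField.adjoin ℚ {Complex.I, theta m}

/-- The conjugates `α^(j,k) = σ_{j,k}(α)` of `α ∈ O_K` under a family of embeddings. -/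
noncomputable def conjs (m : ℕ) (σ : Fin 2 → Fin 4 → (Kfield m →ₐ[ℚ] ℂ))
    (α : 𝓞 (Kfield m)) (j : Fin 2) (k : Fin 4) : ℂ :=
  σ j k (algebraMap (𝓞 (Kfield m)) (Kfield m) α)

/-- `S₁`, formed from a system `a j k` of conjugates. -/
noncomputable def S1 (a : Fin 2 → Fin 4 → ℂ) : ℂ :=
  ∏ j : Fin 2, ((a j 0 - a j 1) * (a j 1 - a j 2) * (a j 2 - a j 3) * (a j 3 - a j 0))

/-- `S₂`, formed from a system `a j k` of conjugates. -/
noncomputable def S2 (a : Fin 2 → Fin 4 → ℂ) : ℂ :=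
  ∏ j : Fin 2, ((a j 0 - a j 2) * (a j 1 - a j 3))

/-- `S₃`, formed from a system `a j k` of conjugates. -/
noncomputable def S3 (a : Fin 2 → Fin 4 → ℂ) : ℂ :=
  (a 0 0 - a 1 0) * (a 0 1 - a 1 1) * (a 0 2 - a 1 2) * (a 0 3 - a 1 3)

/-- `S₄`, formed from a system `a j k` of conjugates. -/
noncomputable def S4 (a : Fin 2 → Fin 4 → ℂ) : ℂ :=
  (a 0 0 - a 1 3) * (a 0 1 - a 1 0) * (a 0 2 - a 1 1) * (a 0 3 - a 1 2)

/-- `S₅`, formed from a system `a j k` of conjugates. -/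
noncomputable def S5 (a : Fin 2 → Fin 4 → ℂ) : ℂ :=
  (a 0 0 - a 1 2) * (a 0 1 - a 1 3) * (a 0 2 - a 1 0) * (a 0 3 - a 1 1)

/-- `S₆`, formed from a system `a j k` of conjugates. -/
noncomputable def S6 (a : Fin 2 → Fin 4 → ℂ) : ℂ :=
  (a 0 0 - a 1 1) * (a 0 1 - a 1 2) * (a 0 2 - a 1 3) * (a 0 3 - a 1 0)

/-- The relations between `i`, `θ`, `η = θ² / (1 + i)` and `ω = (η + 1) θ / (1 + i)`
when `θ ^ 4 = 2 (2 t + 1)`. -/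
structure QuarticRelations {R : Type*} [CommRing R] (t : ℤ) (i θ η ω : R) : Prop where
  i_sq : i ^ 2 = -1
  eta : (1 + i) * η = θ ^ 2
  omega : (1 + i) * ω = (η + 1) * θ
  eta_sq : η ^ 2 = -i * (2 * t + 1)

/-- The image of the Gaussian integers under `a + b i ↦ a + b i`, for a square root `i` of `-1`. -/
def gaussianSubring {R : Type*} [CommRing R] (i : R) (hi : i ^ 2 = -1) : Subring R :=
  (Zsqrtd.lift (d := -1) ⟨i, by push_cast; rw [← hi, sq]⟩).range

theorem mem_gaussianSubring {R : Type*} [CommRing R] {i : R} {hi : i ^ 2 = -1} {x : R} :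
    x ∈ gaussianSubring i hi ↔ ∃ a b : ℤ, x = a + b * i := by
  constructor
  · rintro ⟨⟨a, b⟩, rfl⟩
    exact ⟨a, b, by simp [Zsqrtd.lift]⟩
  · rintro ⟨a, b, rfl⟩
    exact ⟨⟨a, b⟩, by simp [Zsqrtd.lift]⟩

theorem self_mem_gaussianSubring {R : Type*} [CommRing R] {i : R} (hi : i ^ 2 = -1) :
    i ∈ gaussianSubring i hi :=
  mem_gaussianSubring.2 ⟨0, 1, by simp⟩

theorem mem_of_sub_one_mem_of_mul_mem {R : Type*} [CommRing R] {J : Ideal R} {e x : R}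
    (he : e - 1 ∈ J) (h : e * x ∈ J) : x ∈ J := by
  have := J.sub_mem h (J.mul_mem_right x he)
  convert this using 1
  ring

namespace QuarticRelations

variable {R : Type*} [CommRing R] {t : ℤ} {i θ η ω : R}

theorem one_add_i_ne_zero [CharZero R] (h : QuarticRelations t i θ η ω) : 1 + i ≠ 0 := by
  intro h0
  have : (2 : R) = 0 := by linear_combination (1 - i) * h0 + h.i_sq
  exact two_ne_zero this

theorem theta_pow_four (h : QuarticRelations t i θ η ω) : θ ^ 4 = 2 * (2 * t + 1) := by
  linear_combination -(θ ^ 2 + (1 + i) * η) * h.eta + (1 + i) ^ 2 * h.eta_sq -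
    (i + 2) * (2 * t + 1) * h.i_sq

theorem omega_mul [IsDomain R] [CharZero R] (h : QuarticRelations t i θ η ω) :
    ω * (η - 1) = (-(1 + t) - t * i) * θ := by
  apply mul_left_cancel₀ h.one_add_i_ne_zero
  linear_combination (η - 1) * h.omega + θ * h.eta_sq + t * θ * h.i_sq

theorem omega_sq [IsDomain R] [CharZero R] (h : QuarticRelations t i θ η ω) :
    ω ^ 2 = η * ((-t - (1 + t) * i) + (1 - i) * η) := by
  apply mul_left_cancel₀ h.one_add_i_ne_zero
  apply mul_left_cancel₀ h.one_add_i_ne_zero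
  linear_combination ((1 + i) * ω + (η + 1) * θ) * h.omega - (η + 1) ^ 2 * h.eta +
    (1 + i) * η * h.eta_sq + (1 + i) * η * (1 + t + η) * h.i_sq

/-- The `ℤ[i]`-lattice with basis `1, η, θ, ω`. -/
def lattice (h : QuarticRelations t i θ η ω) : Set R :=
  {z | ∃ x₀ ∈ gaussianSubring i h.i_sq, ∃ x₁ ∈ gaussianSubring i h.i_sq,
    ∃ x₂ ∈ gaussianSubring i h.i_sq, ∃ x₃ ∈ gaussianSubring i h.i_sq,
      z = x₀ + x₁ * η + x₂ * θ + x₃ * ω}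

theorem mul_mem_lattice (h : QuarticRelations t i θ η ω) {x z : R}
    (hx : x ∈ gaussianSubring i h.i_sq) (hz : z ∈ h.lattice) : x * z ∈ h.lattice := by
  obtain ⟨x₀, h₀, x₁, h₁, x₂, h₂, x₃, h₃, rfl⟩ := hz
  exact ⟨x * x₀, mul_mem hx h₀, x * x₁, mul_mem hx h₁, x * x₂, mul_mem hx h₂,
    x * x₃, mul_mem hx h₃, by ring⟩

theorem two_mem (h : QuarticRelations t i θ η ω) {J : Ideal R} (hJ : 1 + i ∈ J) : (2 : R) ∈ J := by
  have := J.mul_mem_left (1 - i) hJ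
  convert this using 1
  linear_combination h.i_sq

theorem exists_eq_mul_of_mem (h : QuarticRelations t i θ η ω) {J : Ideal R} (hJ : 1 + i ∈ J)
    (hJZ : ∀ n : ℤ, (n : R) ∈ J → (2 : ℤ) ∣ n) {x : R} (hx : x ∈ gaussianSubring i h.i_sq)
    (hxJ : x ∈ J) : ∃ y ∈ gaussianSubring i h.i_sq, x = (1 + i) * y := by
  obtain ⟨a, b, rfl⟩ := mem_gaussianSubring.1 hx
  have hab : ((a - b : ℤ) : R) ∈ J := by
    convert J.sub_mem hxJ (J.mul_mem_left (b : R) hJ) using 1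
    push_cast
    ring
  obtain ⟨c, hc⟩ := hJZ _ hab
  obtain rfl : a = b + 2 * c := by omega
  refine ⟨_, mem_gaussianSubring.2 ⟨b + c, -c, rfl⟩, ?_⟩
  push_cast
  linear_combination (c : R) * h.i_sq

/-- An integer of the form `-t - (1 + t) i` is congruent to `1` modulo `1 + i`. -/
theorem neg_sub_mul_sub_one_mem {J : Ideal R} (hJ : 1 + i ∈ J) :
    -t - (1 + t) * i - 1 ∈ J := by
  convert J.mul_mem_left (-(1 + t : R)) hJ using 1
  ring

theorem eta_sub_one_sq (h : QuarticRelations t i θ η ω) :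
    (η - 1) ^ 2 = (1 + i) * ((-t - (1 + t) * i) - (1 - i) * η) := by
  linear_combination h.eta_sq + (1 + t - η) * h.i_sq

theorem omega_sub_one_sq [IsDomain R] [CharZero R] (h : QuarticRelations t i θ η ω) :
    (ω - 1) ^ 2 = (-t - (1 + t) * i) * (η - 1) +
      (1 + i) * ((-3 * t - 1 - i) - (1 - i) * ω) := by
  linear_combination h.omega_sq + (1 - i) * h.eta_sq + (2 * t + 2 - ω) * h.i_sq

theorem mem_lattice_of_one_add_i_mul_mem [IsDomain R] [CharZero R]
    (h : QuarticRelations t i θ η ω) {J : Ideal R} (hJrad : J.IsRadical) (hJ : 1 + i ∈ J)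
    (hJZ : ∀ n : ℤ, (n : R) ∈ J → (2 : ℤ) ∣ n) {z : R} (hz : (1 + i) * z ∈ h.lattice) :
    z ∈ h.lattice := by
  obtain ⟨x₀, h₀, x₁, h₁, x₂, h₂, x₃, h₃, hz⟩ := hz
  have hπ := h.one_add_i_ne_zero
  have h2 : (1 - i : R) ∈ J := by
    convert J.sub_mem (h.two_mem hJ) hJ using 1
    ring
  obtain ⟨k, hk⟩ : ∃ k : R, k = -(1 + t) - t * i := ⟨_, rfl⟩
  obtain ⟨c, hc⟩ : ∃ c : R, c = -t - (1 + t) * i := ⟨_, rfl⟩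
  have hkJ : k - 1 ∈ J := by
    convert J.sub_mem (J.mul_mem_left (-t : R) hJ) (h.two_mem hJ) using 1
    rw [hk]; ring
  have hcJ : c - 1 ∈ J := hc ▸ neg_sub_mul_sub_one_mem hJ
  obtain ⟨μ, hμ⟩ : ∃ μ, μ = η - 1 := ⟨_, rfl⟩
  obtain ⟨l, hl⟩ : ∃ l, l = ω - 1 := ⟨_, rfl⟩
  obtain ⟨e, he⟩ : ∃ e : R, e = c - (1 - i) * η := ⟨_, rfl⟩
  obtain ⟨f, hf⟩ : ∃ f : R, f = c * e + μ * ((-3 * t - 1 - i) - (1 - i) * ω) := ⟨_, rfl⟩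
  have hμ2 : μ ^ 2 = (1 + i) * e := by rw [hμ, h.eta_sub_one_sq, he, hc]
  have hl2 : l ^ 2 = c * μ + (1 + i) * ((-3 * t - 1 - i) - (1 - i) * ω) := by
    rw [hl, h.omega_sub_one_sq, hc, hμ]
  have hl2μ : l ^ 2 * μ = (1 + i) * f := by
    linear_combination μ * hl2 + c * hμ2 - (1 + i) * hf
  have hμJ : μ ∈ J := hJrad ⟨2, hμ2 ▸ J.mul_mem_right _ hJ⟩
  have hlJ : l ∈ J := hJrad ⟨2, hl2 ▸ J.add_mem (J.mul_mem_left _ hμJ) (J.mul_mem_right _ hJ)⟩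
  have heJ : e - 1 ∈ J := by
    convert J.sub_mem hcJ (J.mul_mem_right η h2) using 1
    rw [he]; ring
  have hfJ : f - 1 ∈ J := by
    convert J.add_mem (J.add_mem (J.mul_mem_left c heJ) hcJ)
      (J.mul_mem_right ((-3 * t - 1 - i) - (1 - i) * ω) hμJ) using 1
    rw [hf]; ring
  have hkθ : k * θ = l * μ + μ := by
    have := h.omega_mul
    rw [← hk] at this
    rw [← this, hl, hμ]; ring
  have hexp : (1 + i) * (k * z) = k * (x₀ + x₁ + x₃) + k * x₃ * l + (k * x₁ + x₂) * μ +
      x₂ * (l * μ) := by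
    rw [hμ, hl] at hkθ ⊢
    linear_combination k * hz + x₂ * hkθ
  have hkG : k ∈ gaussianSubring i h.i_sq := mem_gaussianSubring.2
    ⟨-(1 + t), -t, by rw [hk]; push_cast; ring⟩
  -- the constant coefficient
  have hc₀ : k * (x₀ + x₁ + x₃) ∈ J := by
    have : k * (x₀ + x₁ + x₃) = (1 + i) * (k * z) -
        (k * x₃ * l + ((k * x₁ + x₂) + x₂ * l) * μ) := by
      linear_combination -hexp
    rw [this]
    exact J.sub_mem (J.mul_mem_right _ hJ) (J.add_mem (J.mul_mem_left _ hlJ) (J.mul_mem_left _ hμJ))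
  obtain ⟨y₀, -, hy₀⟩ := h.exists_eq_mul_of_mem hJ hJZ
    (mul_mem hkG (add_mem (add_mem h₀ h₁) h₃)) hc₀
  -- the coefficient of `l`
  have hc₁ : k * x₃ ∈ J := by
    apply mem_of_sub_one_mem_of_mul_mem hfJ
    have : f * (k * x₃) = l * (μ * (k * z - y₀) - (k * x₁ + x₂) * e) - μ * (x₂ * f) := by
      apply mul_left_cancel₀ hπ
      linear_combination -(l * μ) * hexp - (l * μ) * hy₀ - (k * x₃ + x₂ * μ) * hl2μ
        - (k * x₁ + x₂) * l * hμ2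
    rw [this]
    exact J.sub_mem (J.mul_mem_right _ hlJ) (J.mul_mem_right _ hμJ)
  obtain ⟨y₁, -, hy₁⟩ := h.exists_eq_mul_of_mem hJ hJZ (mul_mem hkG h₃) hc₁
  -- the coefficient of `μ`
  have hc₂ : k * x₁ + x₂ ∈ J := by
    apply mem_of_sub_one_mem_of_mul_mem heJ
    have : e * (k * x₁ + x₂) = μ * (k * z - y₀ - y₁ * l) - l * (x₂ * e) := by
      apply mul_left_cancel₀ hπ
      linear_combination -μ * hexp - μ * hy₀ - μ * l * hy₁ - (k * x₁ + x₂ + x₂ * l) * hμ2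
    rw [this]
    exact J.sub_mem (J.mul_mem_right _ hμJ) (J.mul_mem_right _ hlJ)
  obtain ⟨y₂, -, hy₂⟩ := h.exists_eq_mul_of_mem hJ hJZ (add_mem (mul_mem hkG h₁) h₂) hc₂
  -- the coefficient of `l μ`
  have hx₂ : x₂ ∈ J := by
    apply mem_of_sub_one_mem_of_mul_mem hfJ
    have : f * x₂ = l * (k * z - y₀ - y₁ * l - y₂ * μ) := by
      apply mul_left_cancel₀ hπ
      linear_combination -l * hexp - l * hy₀ - l * l * hy₁ - l * μ * hy₂ - x₂ * hl2μ
    rw [this]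
    exact J.mul_mem_right _ hlJ
  have hx₁ : x₁ ∈ J := mem_of_sub_one_mem_of_mul_mem hkJ (by simpa using J.sub_mem hc₂ hx₂)
  have hx₃ : x₃ ∈ J := mem_of_sub_one_mem_of_mul_mem hkJ hc₁
  have hx₀ : x₀ ∈ J := by
    have := mem_of_sub_one_mem_of_mul_mem hkJ hc₀
    convert J.sub_mem this (J.add_mem hx₁ hx₃) using 1
    ring
  obtain ⟨w₀, hw₀, rfl⟩ := h.exists_eq_mul_of_mem hJ hJZ h₀ hx₀
  obtain ⟨w₁, hw₁, rfl⟩ := h.exists_eq_mul_of_mem hJ hJZ h₁ hx₁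
  obtain ⟨w₂, hw₂, rfl⟩ := h.exists_eq_mul_of_mem hJ hJZ h₂ hx₂
  obtain ⟨w₃, hw₃, rfl⟩ := h.exists_eq_mul_of_mem hJ hJZ h₃ hx₃
  refine ⟨w₀, hw₀, w₁, hw₁, w₂, hw₂, w₃, hw₃, mul_left_cancel₀ hπ ?_⟩
  linear_combination hz

theorem mem_lattice_of_two_mul_mem [IsDomain R] [CharZero R]
    (h : QuarticRelations t i θ η ω) {J : Ideal R} (hJrad : J.IsRadical) (hJ : 1 + i ∈ J)
    (hJZ : ∀ n : ℤ, (n : R) ∈ J → (2 : ℤ) ∣ n) {z : R} (hz : 2 * z ∈ h.lattice) :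
    z ∈ h.lattice := by
  refine h.mem_lattice_of_one_add_i_mul_mem hJrad hJ hJZ
    (h.mem_lattice_of_one_add_i_mul_mem hJrad hJ hJZ ?_)
  convert h.mul_mem_lattice (self_mem_gaussianSubring h.i_sq) hz using 1
  linear_combination z * h.i_sq

theorem mem_lattice_of_odd_mul_mem [IsDomain R] [CharZero R]
    (h : QuarticRelations t i θ η ω) {J : Ideal R} (hJrad : J.IsRadical)
    (hJ : (2 * t + 1 : R) ∈ J)
    (hJG : ∀ x ∈ gaussianSubring i h.i_sq, 2 * x ∈ J →
      ∃ y ∈ gaussianSubring i h.i_sq, x = (2 * t + 1) * y)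
    {z : R} (hz : (2 * t + 1) * z ∈ h.lattice) : z ∈ h.lattice := by
  obtain ⟨x₀, h₀, x₁, h₁, x₂, h₂, x₃, h₃, hz⟩ := hz
  obtain ⟨u, hu⟩ : ∃ u : R, u = 2 * t + 1 := ⟨_, rfl⟩
  have hu0 : u ≠ 0 := by
    rw [hu]
    have : (2 * t + 1 : ℤ) ≠ 0 := by omega
    exact_mod_cast this
  rw [← hu] at hJ hz
  simp only [← hu] at hJG
  have hθ4 : θ ^ 4 = 2 * u := hu ▸ h.theta_pow_four
  have hθ : θ ∈ J := hJrad ⟨4, hθ4 ▸ J.mul_mem_left _ hJ⟩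
  have hi : i ∈ gaussianSubring i h.i_sq := self_mem_gaussianSubring h.i_sq
  have hG2 : (2 : R) ∈ gaussianSubring i h.i_sq := ofNat_mem _ 2
  have hexp : u * (2 * i * z) = 2 * i * x₀ + (2 * i * x₂ + (1 + i) * x₃) * θ +
      (1 + i) * x₁ * θ ^ 2 + x₃ * θ ^ 3 := by
    linear_combination 2 * i * hz + ((1 + i) * x₁ + x₃ * θ) * h.eta + (1 + i) * x₃ * h.omega
      - (x₁ * η + x₃ * ω) * h.i_sq
  have hc₀ : 2 * (i * x₀) ∈ J := by
    have : 2 * (i * x₀) = u * (2 * i * z) - θ * ((2 * i * x₂ + (1 + i) * x₃) +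
      (1 + i) * x₁ * θ + x₃ * θ ^ 2) := by linear_combination -hexp
    rw [this]
    exact J.sub_mem (J.mul_mem_right _ hJ) (J.mul_mem_right _ hθ)
  obtain ⟨y₀, hy₀, e₀⟩ := hJG _ (mul_mem hi h₀) hc₀
  have hc₁ : 2 * (2 * i * x₂ + (1 + i) * x₃) ∈ J := by
    have : 2 * (2 * i * x₂ + (1 + i) * x₃) = θ * (θ ^ 2 * (2 * i * z - 2 * y₀) -
        2 * (1 + i) * x₁ - 2 * x₃ * θ) := by
      apply mul_left_cancel₀ hu0
      linear_combination -θ ^ 3 * hexp - 2 * θ ^ 3 * e₀ -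
        ((2 * i * x₂ + (1 + i) * x₃) + (1 + i) * x₁ * θ + x₃ * θ ^ 2) * hθ4
    rw [this]
    exact J.mul_mem_right _ hθ
  obtain ⟨y₁, hy₁, e₁⟩ := hJG _ (add_mem (mul_mem (mul_mem hG2 hi) h₂)
    (mul_mem (add_mem (one_mem _) hi) h₃)) hc₁
  have hc₂ : 2 * ((1 + i) * x₁) ∈ J := by
    have : 2 * ((1 + i) * x₁) = θ * (θ * (2 * i * z - 2 * y₀ - y₁ * θ) - 2 * x₃) := by
      apply mul_left_cancel₀ hu0
      linear_combination -θ ^ 2 * hexp - 2 * θ ^ 2 * e₀ - θ ^ 3 * e₁ -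
        ((1 + i) * x₁ + x₃ * θ) * hθ4
    rw [this]
    exact J.mul_mem_right _ hθ
  obtain ⟨y₂, hy₂, e₂⟩ := hJG _ (mul_mem (add_mem (one_mem _) hi) h₁) hc₂
  have hc₃ : 2 * x₃ ∈ J := by
    have : 2 * x₃ = θ * (2 * i * z - 2 * y₀ - y₁ * θ - y₂ * θ ^ 2) := by
      apply mul_left_cancel₀ hu0
      linear_combination -θ * hexp - 2 * θ * e₀ - θ ^ 2 * e₁ - θ ^ 3 * e₂ - x₃ * hθ4
    rw [this]
    exact J.mul_mem_right _ hθ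
  have hx₀ : 2 * x₀ ∈ J := by
    convert J.mul_mem_left (-i) hc₀ using 1
    linear_combination 2 * x₀ * h.i_sq
  have hx₁ : 2 * x₁ ∈ J := by
    have : (1 + i) * x₁ ∈ J := e₂ ▸ J.mul_mem_right _ hJ
    convert J.mul_mem_left (1 - i) this using 1
    linear_combination x₁ * h.i_sq
  have hx₂ : 2 * x₂ ∈ J := by
    obtain ⟨y₃, -, e₃⟩ := hJG _ h₃ hc₃
    have : 2 * x₂ = u * (-i * (y₁ - (1 + i) * y₃)) := by
      linear_combination -i * e₁ + i * (1 + i) * e₃ + 2 * x₂ * h.i_sq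
    rw [this]
    exact J.mul_mem_right _ hJ
  obtain ⟨w₀, hw₀, rfl⟩ := hJG _ h₀ hx₀
  obtain ⟨w₁, hw₁, rfl⟩ := hJG _ h₁ hx₁
  obtain ⟨w₂, hw₂, rfl⟩ := hJG _ h₂ hx₂
  obtain ⟨w₃, hw₃, rfl⟩ := hJG _ h₃ hc₃
  refine ⟨w₀, hw₀, w₁, hw₁, w₂, hw₂, w₃, hw₃, mul_left_cancel₀ hu0 ?_⟩
  linear_combination hz

/-- The conjugates of `x 0 + x 1 * η + x 2 * θ + x 3 * ω` under `i ↦ (-1) ^ j i`, `θ ↦ i ^ k θ`,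
where `y` is the conjugate of `x` under `i ↦ -i`. -/
def conjugates (i θ η ω : R) (x y : Fin 4 → R) : Fin 2 → Fin 4 → R :=
  ![![x 0 + x 1 * η + x 2 * θ + x 3 * ω,
      x 0 - x 1 * η + x 2 * (i * θ) + x 3 * ((1 + i) * θ - i * ω),
      x 0 + x 1 * η - x 2 * θ - x 3 * ω,
      x 0 - x 1 * η - x 2 * (i * θ) - x 3 * ((1 + i) * θ - i * ω)],
    ![y 0 + y 1 * (i * η) + y 2 * θ + y 3 * (θ - ω),
      y 0 - y 1 * (i * η) + y 2 * (i * θ) + y 3 * (i * ω - θ),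
      y 0 + y 1 * (i * η) - y 2 * θ - y 3 * (θ - ω),
      y 0 - y 1 * (i * η) - y 2 * (i * θ) - y 3 * (i * ω - θ)]]

theorem conjugates_sub_succ_mem (h : QuarticRelations t i θ η ω) (x y : Fin 4 → R) (j : Fin 2)
    (k : Fin 4) : conjugates i θ η ω x y j k - conjugates i θ η ω x y j (k + 1) ∈
      Ideal.span {1 + i} ⊓ Ideal.span {θ} := by
  set I : Ideal R := Ideal.span {1 + i} ⊓ Ideal.span {θ}
  have mem {x : R} (h₁ : 1 + i ∣ x) (h₂ : θ ∣ x) : x ∈ I :=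
    ⟨Ideal.mem_span_singleton.2 h₁, Ideal.mem_span_singleton.2 h₂⟩
  have hθ : (1 + i) * θ ∈ I := mem (dvd_mul_right _ _) (dvd_mul_left _ _)
  have hω : (1 + i) * ω ∈ I := mem (dvd_mul_right _ _) ⟨η + 1, by rw [h.omega]; ring⟩
  have hη : 2 * η ∈ I := mem ⟨(1 - i) * η, by linear_combination η * h.i_sq⟩
    ⟨(1 - i) * θ, by linear_combination (1 - i) * h.eta + η * h.i_sq⟩
  have comb (r₁ r₂ r₃ : R) : r₁ * (2 * η) + r₂ * ((1 + i) * θ) + r₃ * ((1 + i) * ω) ∈ I :=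
    I.add_mem (I.add_mem (I.mul_mem_left _ hη) (I.mul_mem_left _ hθ)) (I.mul_mem_left _ hω)
  have hi := h.i_sq
  fin_cases j <;> fin_cases k <;> simp [conjugates]
  · convert comb (x 1) (-i * x 2 - x 3) (x 3) using 1
    linear_combination x 2 * θ * hi
  · convert comb (-x 1) (x 2 + x 3) (-i * x 3) using 1
    linear_combination x 3 * ω * hi
  · convert comb (x 1) (i * x 2 + x 3) (-x 3) using 1
    linear_combination -x 2 * θ * hi
  · convert comb (-x 1) (-x 2 - x 3) (i * x 3) using 1
    linear_combination -x 3 * ω * hi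
  · convert comb (i * y 1) (-i * y 2 + (1 - i) * y 3) (-y 3) using 1
    linear_combination (y 2 * θ + y 3 * θ) * hi
  · convert comb (-i * y 1) (y 2) (i * y 3) using 1
    linear_combination -y 3 * ω * hi
  · convert comb (i * y 1) (i * y 2 - (1 - i) * y 3) (y 3) using 1
    linear_combination -(y 2 * θ + y 3 * θ) * hi
  · convert comb (-i * y 1) (-y 2) (-i * y 3) using 1
    linear_combination y 3 * ω * hi

theorem conjugates_sub_add_two_mem (h : QuarticRelations t i θ η ω) (x y : Fin 4 → R) (j : Fin 2)
    (k : Fin 4) : conjugates i θ η ω x y j k - conjugates i θ η ω x y j (k + 2) ∈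
      Ideal.span {2} ⊓ Ideal.span {θ} := by
  set I : Ideal R := Ideal.span {2} ⊓ Ideal.span {θ}
  have mem {x : R} (h₁ : 2 ∣ x) (h₂ : θ ∣ x) : x ∈ I :=
    ⟨Ideal.mem_span_singleton.2 h₁, Ideal.mem_span_singleton.2 h₂⟩
  have hθ : 2 * θ ∈ I := mem (dvd_mul_right _ _) (dvd_mul_left _ _)
  have hω : 2 * ω ∈ I := mem (dvd_mul_right _ _)
    ⟨(1 - i) * (η + 1), by linear_combination (1 - i) * h.omega + ω * h.i_sq⟩
  have comb (r₁ r₂ : R) : r₁ * (2 * θ) + r₂ * (2 * ω) ∈ I :=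
    I.add_mem (I.mul_mem_left _ hθ) (I.mul_mem_left _ hω)
  fin_cases j <;> fin_cases k <;> simp [conjugates]
  · convert comb (x 2) (x 3) using 1; ring
  · convert comb (x 2 * i + x 3 * (1 + i)) (-i * x 3) using 1; ring
  · convert comb (-x 2) (-x 3) using 1; ring
  · convert comb (-(x 2 * i + x 3 * (1 + i))) (i * x 3) using 1; ring
  · convert comb (y 2 + y 3) (-y 3) using 1; ring
  · convert comb (y 2 * i - y 3) (i * y 3) using 1; ring
  · convert comb (-(y 2 + y 3)) (y 3) using 1; ring
  · convert comb (-(y 2 * i - y 3)) (-i * y 3) using 1; ring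

theorem conjugates_sub_mem (h : QuarticRelations t i θ η ω) {J : Ideal R} (hJrad : J.IsRadical)
    (hJ : 1 + i ∈ J) (a b : Fin 4 → ℤ) {x y : Fin 4 → R}
    (hx : ∀ l, x l = a l + b l * i) (hy : ∀ l, y l = a l - b l * i) (k l : Fin 4) :
    conjugates i θ η ω x y 0 k - conjugates i θ η ω x y 1 l ∈ J := by
  have h2 := h.two_mem hJ
  have hθ : θ ∈ J := hJrad ⟨2, h.eta ▸ J.mul_mem_right _ hJ⟩
  have step (j : Fin 2) (k : Fin 4) :
      conjugates i θ η ω x y j k - conjugates i θ η ω x y j (k + 1) ∈ J :=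
    (Ideal.span_singleton_le_iff_mem J).2 hJ (h.conjugates_sub_succ_mem x y j k).1
  have base (j : Fin 2) (k : Fin 4) :
      conjugates i θ η ω x y j 0 - conjugates i θ η ω x y j k ∈ J := by
    have h₀ : _ - conjugates i θ η ω x y j 1 ∈ J := step j 0
    have h₁ : _ - conjugates i θ η ω x y j 2 ∈ J :=
      sub_add_sub_cancel (G := R) _ _ _ ▸ J.add_mem h₀ (step j 1)
    have h₂ : _ - conjugates i θ η ω x y j 3 ∈ J :=
      sub_add_sub_cancel (G := R) _ _ _ ▸ J.add_mem h₁ (step j 2)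
    fin_cases k
    · simp
    exacts [h₀, h₁, h₂]
  have h₀₀ : conjugates i θ η ω x y 0 0 - conjugates i θ η ω x y 1 0 ∈ J := by
    have : conjugates i θ η ω x y 0 0 - conjugates i θ η ω x y 1 0 =
        (b 0 * i + a 3 * ω + (a 1 - b 1) * η) * 2 - (a 1 - b 1) * η * (1 + i) +
          (2 * b 2 * i - (a 3 - b 3 * i)) * θ := by
      simp [conjugates, hx, hy]
      linear_combination b 1 * η * h.i_sq
    rw [this]
    exact J.add_mem (J.sub_mem (J.mul_mem_left _ h2) (J.mul_mem_left _ hJ)) (J.mul_mem_left _ hθ)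
  convert J.add_mem (J.sub_mem h₀₀ (base 0 k)) (base 1 l) using 1
  ring

end QuarticRelations

theorem isIntegral_ratCast_iff {q : ℚ} : IsIntegral ℤ (q : ℂ) ↔ ∃ n : ℤ, q = n := by
  rw [← eq_ratCast (algebraMap ℚ ℂ), isIntegral_algebraMap_iff (algebraMap ℚ ℂ).injective,
    IsIntegrallyClosed.isIntegral_iff]
  simp [eq_comm]

theorem intCast_dvd_intCast_integralClosure {d n : ℤ}
    (h : (d : integralClosure ℤ ℂ) ∣ n) : d ∣ n := by
  obtain ⟨γ, hγ⟩ := h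
  have hγ' : (n : ℂ) = d * γ := by exact_mod_cast congrArg Subtype.val hγ
  rcases eq_or_ne d 0 with rfl | hd
  · simp at hγ'
    simp [hγ']
  have hd' : (d : ℂ) ≠ 0 := by exact_mod_cast hd
  have : ((n / d : ℚ) : ℂ) = γ := by
    push_cast
    rw [hγ']
    field_simp
  obtain ⟨q, hq⟩ := isIntegral_ratCast_iff.1 (this ▸ γ.2 : IsIntegral ℤ ((n / d : ℚ) : ℂ))
  refine ⟨q, ?_⟩
  have hd'' : (d : ℚ) ≠ 0 := by exact_mod_cast hd
  field_simp at hq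
  exact_mod_cast hq

theorem dvd_of_mem_radical_integralClosure {d n : ℤ} (hd : Squarefree d)
    (h : (n : integralClosure ℤ ℂ) ∈ (Ideal.span {(d : integralClosure ℤ ℂ)}).radical) :
    d ∣ n := by
  obtain ⟨k, hk⟩ := h
  rw [Ideal.mem_span_singleton, ← Int.cast_pow] at hk
  exact hd.isRadical k _ (intCast_dvd_intCast_integralClosure hk)

theorem star_mem_radical_integralClosure {d : ℤ} {x y : integralClosure ℤ ℂ}
    (hxy : star (x : ℂ) = y)
    (h : x ∈ (Ideal.span {(d : integralClosure ℤ ℂ)}).radical) :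
    y ∈ (Ideal.span {(d : integralClosure ℤ ℂ)}).radical := by
  obtain ⟨k, hk⟩ := h
  obtain ⟨γ, hγ⟩ := Ideal.mem_span_singleton.1 hk
  refine ⟨k, Ideal.mem_span_singleton.2
    ⟨⟨star (γ : ℂ), γ.2.map (Complex.conjAe.toAlgHom.restrictScalars ℤ)⟩, Subtype.ext ?_⟩⟩
  have := congrArg (fun z : integralClosure ℤ ℂ => star (z : ℂ)) hγ
  simpa [← hxy] using this

/-- The value at `I ^ k θ` of the cubic polynomial with coefficients `c`. -/
noncomputable def rotatedCubic (c : Fin 4 → ℂ) (θ : ℂ) (k : ℕ) : ℂ :=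
  ∑ l : Fin 4, c l * (Complex.I ^ k * θ) ^ (l : ℕ)

theorem rotatedCubic_sub_add (c d : Fin 4 → ℂ) (θ : ℂ) (k s : ℕ) :
    rotatedCubic c θ k - rotatedCubic d θ (k + s) =
      rotatedCubic (fun l => c l - Complex.I ^ (s * l) * d l) θ k := by
  rw [rotatedCubic, rotatedCubic, rotatedCubic, ← Finset.sum_sub_distrib]
  refine Finset.sum_congr rfl fun l _ => ?_
  ring

theorem rotatedCubic_add_four (c : Fin 4 → ℂ) (θ : ℂ) (k : ℕ) :
    rotatedCubic c θ (k + 4) = rotatedCubic c θ k := by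
  simp [rotatedCubic, pow_add]

theorem rotatedCubic_zero (c : Fin 4 → ℂ) (θ : ℂ) :
    rotatedCubic c θ 0 = c 0 + c 1 * θ + c 2 * θ ^ 2 + c 3 * θ ^ 3 := by
  simp [rotatedCubic, Fin.sum_univ_four]

theorem rotatedCubic_one (c : Fin 4 → ℂ) (θ : ℂ) :
    rotatedCubic c θ 1 = c 0 + Complex.I * c 1 * θ - c 2 * θ ^ 2 - Complex.I * c 3 * θ ^ 3 := by
  simp [rotatedCubic, Fin.sum_univ_four]
  linear_combination (c 2 * θ ^ 2 + Complex.I * c 3 * θ ^ 3) * Complex.I_sq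

theorem rotatedCubic_two (c : Fin 4 → ℂ) (θ : ℂ) :
    rotatedCubic c θ 2 = c 0 - c 1 * θ + c 2 * θ ^ 2 - c 3 * θ ^ 3 := by
  simp [rotatedCubic, Fin.sum_univ_four]
  ring

theorem rotatedCubic_three (c : Fin 4 → ℂ) (θ : ℂ) :
    rotatedCubic c θ 3 = c 0 - Complex.I * c 1 * θ - c 2 * θ ^ 2 + Complex.I * c 3 * θ ^ 3 := by
  simp [rotatedCubic, Fin.sum_univ_four, Complex.I_pow_three]
  linear_combination (c 2 * θ ^ 2 - Complex.I * c 3 * θ ^ 3) * Complex.I_sq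

theorem prod_rotatedCubic_mem {A : Type*} [SetLike A ℂ] [SubringClass A ℂ] {S : A} {c : Fin 4 → ℂ}
    {θ : ℂ} (hc : ∀ l, c l ∈ S) (hθ : θ ^ 4 ∈ S) :
    rotatedCubic c θ 0 * rotatedCubic c θ 1 * rotatedCubic c θ 2 * rotatedCubic c θ 3 ∈ S := by
  have h2 : (2 : ℂ) ∈ S := ofNat_mem S 2
  have key : rotatedCubic c θ 0 * rotatedCubic c θ 1 * rotatedCubic c θ 2 * rotatedCubic c θ 3 =
      (c 0 ^ 2 + c 2 ^ 2 * θ ^ 4 - 2 * c 1 * c 3 * θ ^ 4) ^ 2 -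
        θ ^ 4 * (2 * c 0 * c 2 - c 1 ^ 2 - c 3 ^ 2 * θ ^ 4) ^ 2 := by
    rw [rotatedCubic_zero, rotatedCubic_one, rotatedCubic_two, rotatedCubic_three]
    linear_combination (-(c 1 * θ - c 3 * θ ^ 3) ^ 2 *
      ((c 0 + c 2 * θ ^ 2) ^ 2 - (c 1 * θ + c 3 * θ ^ 3) ^ 2)) * Complex.I_sq
  rw [key]
  have h (l) := hc l
  exact sub_mem (pow_mem (sub_mem (add_mem (pow_mem (h 0) 2) (mul_mem (pow_mem (h 2) 2) hθ))
    (mul_mem (mul_mem (mul_mem h2 (h 1)) (h 3)) hθ)) 2)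
    (mul_mem hθ (pow_mem (sub_mem (sub_mem (mul_mem (mul_mem h2 (h 0)) (h 2)) (pow_mem (h 1) 2))
      (mul_mem (pow_mem (h 3) 2) hθ)) 2))

theorem isIntegral_mul_pow_of_rotatedCubic {c : Fin 4 → ℂ} {θ : ℂ}
    (h : ∀ k, IsIntegral ℤ (rotatedCubic c θ k)) (l : Fin 4) :
    IsIntegral ℤ (4 * c l * θ ^ (l : ℕ)) := by
  have hI : IsIntegral ℤ Complex.I := Complex.isIntegral_int_I
  have h₀ := h 0
  have h₁ := h 1
  have h₂ := h 2
  have h₃ := h 3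
  have e₀ := rotatedCubic_zero c θ
  have e₁ := rotatedCubic_one c θ
  have e₂ := rotatedCubic_two c θ
  have e₃ := rotatedCubic_three c θ
  set r := rotatedCubic c θ
  fin_cases l
  · have e : 4 * c 0 * θ ^ 0 = r 0 + r 1 + r 2 + r 3 := by
      linear_combination -e₀ - e₁ - e₂ - e₃
    exact e ▸ ((h₀.add h₁).add h₂).add h₃
  · have e : 4 * c 1 * θ ^ 1 = r 0 - Complex.I * r 1 - r 2 + Complex.I * r 3 := by
      linear_combination -e₀ + Complex.I * e₁ + e₂ - Complex.I * e₃ +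
        2 * (c 1 * θ - c 3 * θ ^ 3) * Complex.I_sq
    exact e ▸ ((h₀.sub (hI.mul h₁)).sub h₂).add (hI.mul h₃)
  · have e : 4 * c 2 * θ ^ 2 = r 0 - r 1 + r 2 - r 3 := by
      linear_combination -e₀ + e₁ - e₂ + e₃
    exact e ▸ ((h₀.sub h₁).add h₂).sub h₃
  · have e : 4 * c 3 * θ ^ 3 = r 0 + Complex.I * r 1 - r 2 - Complex.I * r 3 := by
      linear_combination -e₀ - Complex.I * e₁ + e₂ + Complex.I * e₃ -
        2 * (c 1 * θ - c 3 * θ ^ 3) * Complex.I_sq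
    exact e ▸ ((h₀.add (hI.mul h₁)).sub h₂).sub (hI.mul h₃)

theorem mem_adjoin_I {z : ℂ} :
    z ∈ Algebra.adjoin ℚ {Complex.I} ↔ ∃ a b : ℚ, z = a + b * Complex.I := by
  constructor
  · intro hz
    induction hz using Algebra.adjoin_induction with
    | mem x hx => exact ⟨0, 1, by simpa using hx⟩
    | algebraMap r => exact ⟨r, 0, by simp⟩
    | add x y _ _ hx hy =>
      obtain ⟨a, b, rfl⟩ := hx
      obtain ⟨c, d, rfl⟩ := hy
      exact ⟨a + c, b + d, by push_cast; ring⟩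
    | mul x y _ _ hx hy =>
      obtain ⟨a, b, rfl⟩ := hx
      obtain ⟨c, d, rfl⟩ := hy
      refine ⟨a * c - b * d, a * d + b * c, ?_⟩
      push_cast
      linear_combination (b * d : ℂ) * Complex.I_sq
  · rintro ⟨a, b, rfl⟩
    exact add_mem (algebraMap_mem _ a)
      (mul_mem (algebraMap_mem _ b) (Algebra.self_mem_adjoin_singleton ℚ _))

theorem exists_intCast_eq_of_star_eq {z : ℂ} (hz : IsIntegral ℤ z)
    (hQ : z ∈ Algebra.adjoin ℚ {Complex.I}) (hs : star z = z) : ∃ n : ℤ, z = n := by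
  obtain ⟨a, b, rfl⟩ := mem_adjoin_I.1 hQ
  have hb : (b : ℝ) = 0 := by
    have := congrArg Complex.im hs
    simp at this
    have : (b : ℝ) = 0 := by linarith
    exact_mod_cast this
  obtain rfl : b = 0 := by exact_mod_cast hb
  obtain ⟨n, rfl⟩ := (isIntegral_ratCast_iff (q := a)).1 (by simpa using hz)
  exact ⟨n, by simp⟩

theorem theta_pow_four (m : ℕ) : theta m ^ 4 = m := by
  have : ((m : ℝ) ^ ((1 : ℝ) / 4)) ^ 4 = m := by
    rw [← Real.rpow_natCast, ← Real.rpow_mul (by positivity)]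
    norm_num
  rw [theta]
  exact_mod_cast this

theorem star_theta (m : ℕ) : star (theta m) = theta m :=
  Complex.conj_ofReal _

theorem isIntegral_theta (m : ℕ) : IsIntegral ℤ (theta m) := by
  refine .of_pow (n := 4) (by norm_num) ?_
  rw [theta_pow_four]
  exact_mod_cast isIntegral_algebraMap (R := ℤ) (A := ℂ) (x := (m : ℤ))

/-- Every element of `K` is a cubic polynomial in `θ` with coefficients in `ℚ(i)`. -/
theorem exists_coordinates {m : ℕ} (x : Kfield m) : ∃ p q : Fin 4 → ℚ,
    (x : ℂ) = rotatedCubic (fun l => p l + q l * Complex.I) (theta m) 0 := by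
  have hθ4 := theta_pow_four m
  set S := Algebra.adjoin ℚ {Complex.I}
  have hint : ∀ y ∈ ({Complex.I, theta m} : Set ℂ), IsAlgebraic ℚ y := by
    rintro y (rfl | rfl)
    · exact (Complex.isIntegral_int_I.tower_top (A := ℚ)).isAlgebraic
    · exact ((isIntegral_theta m).tower_top (A := ℚ)).isAlgebraic
  have hx : (x : ℂ) ∈ Algebra.adjoin ℚ {Complex.I, theta m} := by
    rw [← IntermediateField.adjoin_toSubalgebra_of_isAlgebraic hint]
    exact x.2
  have hmS : (m : ℂ) ∈ S := natCast_mem S m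
  obtain ⟨c, hc, hcx⟩ : ∃ c : Fin 4 → ℂ, (∀ l, c l ∈ S) ∧
      (x : ℂ) = rotatedCubic c (theta m) 0 := by
    generalize (x : ℂ) = z at hx
    simp only [rotatedCubic_zero]
    induction hx using Algebra.adjoin_induction with
    | mem z hz =>
      rcases hz with rfl | rfl
      · exact ⟨![Complex.I, 0, 0, 0], by
          simp [Fin.forall_fin_succ, S, Algebra.self_mem_adjoin_singleton], by simp⟩
      · exact ⟨![0, 1, 0, 0], by simp [Fin.forall_fin_succ], by simp⟩
    | algebraMap r =>
      exact ⟨![algebraMap ℚ ℂ r, 0, 0, 0], by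
        simp only [Fin.forall_fin_succ]; simp [algebraMap_mem S r, -eq_ratCast], by simp⟩
    | add z w _ _ hz hw =>
      obtain ⟨c, hc, rfl⟩ := hz
      obtain ⟨d, hd, rfl⟩ := hw
      exact ⟨c + d, fun l => add_mem (hc l) (hd l), by simp only [Pi.add_apply]; ring⟩
    | mul z w _ _ hz hw =>
      obtain ⟨c, hc, rfl⟩ := hz
      obtain ⟨d, hd, rfl⟩ := hw
      have h (k l) : c k * d l ∈ S := mul_mem (hc k) (hd l)
      refine ⟨![c 0 * d 0 + m * (c 1 * d 3 + c 2 * d 2 + c 3 * d 1),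
        c 0 * d 1 + c 1 * d 0 + m * (c 2 * d 3 + c 3 * d 2),
        c 0 * d 2 + c 1 * d 1 + c 2 * d 0 + m * (c 3 * d 3),
        c 0 * d 3 + c 1 * d 2 + c 2 * d 1 + c 3 * d 0], ?_, ?_⟩
      · intro l
        fin_cases l
        · exact add_mem (h 0 0) (mul_mem hmS (add_mem (add_mem (h 1 3) (h 2 2)) (h 3 1)))
        · exact add_mem (add_mem (h 0 1) (h 1 0)) (mul_mem hmS (add_mem (h 2 3) (h 3 2)))
        · exact add_mem (add_mem (add_mem (h 0 2) (h 1 1)) (h 2 0)) (mul_mem hmS (h 3 3))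
        · exact add_mem (add_mem (add_mem (h 0 3) (h 1 2)) (h 2 1)) (h 3 0)
      · simp
        linear_combination (c 1 * d 3 + c 2 * d 2 + c 3 * d 1 + (c 2 * d 3 + c 3 * d 2) * theta m +
          c 3 * d 3 * theta m ^ 2) * hθ4
  choose p q hpq using fun l => mem_adjoin_I.1 (hc l)
  exact ⟨p, q, by rw [hcx, funext hpq]⟩

theorem algHom_eq_rotatedCubic {m : ℕ} (τ : Kfield m →ₐ[ℚ] ℂ) {j : Fin 2} {k : Fin 4}
    (hI : ∀ x : Kfield m, (x : ℂ) = Complex.I → τ x = (-1 : ℂ) ^ (j : ℕ) * Complex.I)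
    (hθ : ∀ x : Kfield m, (x : ℂ) = theta m → τ x = Complex.I ^ (k : ℕ) * theta m)
    {x : Kfield m} {p q : Fin 4 → ℚ}
    (hx : (x : ℂ) = rotatedCubic (fun l => p l + q l * Complex.I) (theta m) 0) :
    τ x = rotatedCubic (fun l => p l + (-1) ^ (j : ℕ) * q l * Complex.I) (theta m) k := by
  let iK : Kfield m := ⟨Complex.I, IntermediateField.subset_adjoin _ _ (by simp)⟩
  let θK : Kfield m := ⟨theta m, IntermediateField.subset_adjoin _ _ (by simp)⟩
  have hx' : x = ∑ l : Fin 4, ((p l : Kfield m) + q l * iK) * θK ^ (l : ℕ) := by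
    apply Subtype.ext
    rw [hx]
    simp [rotatedCubic, iK, θK]
  rw [hx', map_sum, rotatedCubic]
  refine Finset.sum_congr rfl fun l _ => ?_
  rw [map_mul, map_add, map_mul, map_pow, hI iK rfl, hθ θK rfl]
  simp
  left
  ring

theorem coe_ofNat_integralClosure (n : ℕ) [n.AtLeastTwo] :
    ((OfNat.ofNat n : integralClosure ℤ ℂ) : ℂ) = OfNat.ofNat n :=
  map_ofNat (algebraMap (integralClosure ℤ ℂ) ℂ) n

theorem exists_quarticRelations {m : ℕ} {t : ℤ} (hm : (m : ℤ) = 2 * (2 * t + 1)) :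
    ∃ i θ η ω : integralClosure ℤ ℂ, QuarticRelations t i θ η ω ∧
      (i : ℂ) = Complex.I ∧ (θ : ℂ) = theta m := by
  have hθ4 := theta_pow_four m
  have hI := Complex.I_sq
  have hm' : (m : ℂ) = 2 * (2 * t + 1) := by exact_mod_cast congrArg (Int.cast : ℤ → ℂ) hm
  set η : ℂ := theta m ^ 2 * (1 - Complex.I) / 2 with hη
  set ω : ℂ := (η + 1) * theta m * (1 - Complex.I) / 2 with hω
  have h : QuarticRelations t Complex.I (theta m) η ω := by
    refine ⟨hI, ?_, ?_, ?_⟩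
    · linear_combination (1 + Complex.I) * hη - theta m ^ 2 / 2 * hI
    · linear_combination (1 + Complex.I) * hω - (η + 1) * theta m / 2 * hI
    · rw [hη]
      linear_combination theta m ^ 4 / 4 * hI - Complex.I / 2 * hθ4 - Complex.I / 2 * hm'
  have hi : IsIntegral ℤ Complex.I := Complex.isIntegral_int_I
  have hZ (n : ℤ) : IsIntegral ℤ (n : ℂ) := isIntegral_algebraMap (R := ℤ) (A := ℂ) (x := n)
  have iη : IsIntegral ℤ η := by
    refine .of_pow (n := 2) (by norm_num) ?_
    rw [h.eta_sq]
    exact hi.neg.mul (by exact_mod_cast hZ (2 * t + 1))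
  have iω : IsIntegral ℤ ω := by
    refine .of_pow (n := 2) (by norm_num) ?_
    rw [h.omega_sq]
    exact iη.mul ((((hZ t).neg.sub ((isIntegral_one.add (hZ t)).mul hi))).add
      ((isIntegral_one.sub hi).mul iη))
  refine ⟨⟨_, hi⟩, ⟨_, isIntegral_theta m⟩, ⟨_, iη⟩, ⟨_, iω⟩, ⟨?_, ?_, ?_, ?_⟩, rfl, rfl⟩
  · exact Subtype.ext h.i_sq
  · exact Subtype.ext h.eta
  · exact Subtype.ext h.omega
  · refine Subtype.ext ?_
    push_cast
    exact h.eta_sq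

theorem one_add_mem_radical {R : Type*} [CommRing R] {i : R} (hi : i ^ 2 = -1) :
    1 + i ∈ (Ideal.span {((2 : ℤ) : R)}).radical :=
  ⟨2, Ideal.mem_span_singleton.2 ⟨i, by push_cast; linear_combination hi⟩⟩

theorem exists_eq_mul_of_mem_radical {u : ℤ} (hu : Odd u) (hsq : Squarefree u)
    {i : integralClosure ℤ ℂ} {hi : i ^ 2 = -1} (hI : (i : ℂ) = Complex.I)
    {x : integralClosure ℤ ℂ} (hx : x ∈ gaussianSubring i hi)
    (h : 2 * x ∈ (Ideal.span {(u : integralClosure ℤ ℂ)}).radical) :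
    ∃ y ∈ gaussianSubring i hi, x = u * y := by
  obtain ⟨a, b, rfl⟩ := mem_gaussianSubring.1 hx
  set J := (Ideal.span {(u : integralClosure ℤ ℂ)}).radical
  have h' : 2 * ((a : integralClosure ℤ ℂ) - b * i) ∈ J := by
    refine star_mem_radical_integralClosure ?_ h
    push_cast
    rw [hI, coe_ofNat_integralClosure]
    simp
    ring
  have hcop : IsCoprime u 4 := by
    obtain ⟨k, rfl⟩ := hu
    exact IsCoprime.pow_right (n := 2) (x := 2 * k + 1) (y := 2) ⟨1, -k, by ring⟩
  have key (n : ℤ) (hn : 4 * (n : integralClosure ℤ ℂ) ∈ J) : u ∣ n :=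
    hcop.dvd_of_dvd_mul_left (dvd_of_mem_radical_integralClosure hsq (by exact_mod_cast hn))
  obtain ⟨c, rfl⟩ := key a (by convert J.add_mem h h' using 1; ring)
  obtain ⟨d, rfl⟩ := key b (by
    convert J.mul_mem_left (-i) (J.sub_mem h h') using 1
    linear_combination 4 * b * hi)
  exact ⟨_, mem_gaussianSubring.2 ⟨c, d, rfl⟩, by push_cast; ring⟩

theorem QuarticRelations.mem_lattice {t : ℤ} {i θ η ω : integralClosure ℤ ℂ}
    (h : QuarticRelations t i θ η ω) (hI : (i : ℂ) = Complex.I) (hsq : Squarefree (2 * t + 1))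
    {z : integralClosure ℤ ℂ} {c : Fin 4 → integralClosure ℤ ℂ}
    (hc : ∀ l, c l ∈ gaussianSubring i h.i_sq)
    (hz : 16 * (2 * t + 1) * z = c 0 + c 1 * θ + c 2 * θ ^ 2 + c 3 * θ ^ 3) :
    z ∈ h.lattice := by
  have two {w : integralClosure ℤ ℂ} (hw : 2 * w ∈ h.lattice) : w ∈ h.lattice :=
    h.mem_lattice_of_two_mul_mem (Ideal.radical_isRadical _) (one_add_mem_radical h.i_sq)
      (fun n hn => dvd_of_mem_radical_integralClosure Int.prime_two.squarefree hn) hw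
  have hu : ((2 * t + 1 : ℤ) : integralClosure ℤ ℂ) = 2 * t + 1 := by push_cast; rfl
  have hi : i ∈ gaussianSubring i h.i_sq := self_mem_gaussianSubring h.i_sq
  refine h.mem_lattice_of_odd_mul_mem (Ideal.radical_isRadical _)
    (Ideal.le_radical (Ideal.mem_span_singleton.2 hu.dvd))
    (fun x hx hx2 => by
      simpa only [hu] using exists_eq_mul_of_mem_radical (odd_two_mul_add_one t) hsq hI hx hx2)
    (two (two (two (two ?_))))
  refine ⟨c 0, hc 0, (1 + i) * c 2, mul_mem (add_mem (one_mem _) hi) (hc 2),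
    c 1 - (1 + i) * c 3, sub_mem (hc 1) (mul_mem (add_mem (one_mem _) hi) (hc 3)),
    2 * i * c 3, mul_mem (mul_mem (ofNat_mem _ 2) hi) (hc 3), ?_⟩
  linear_combination hz - (c 2 + c 3 * θ) * h.eta - (1 + i) * c 3 * h.omega + c 3 * ω * h.i_sq

theorem exists_intCast_coordinates {m : ℕ} {p q : Fin 4 → ℚ}
    (h₀ : ∀ k, IsIntegral ℤ (rotatedCubic (fun l => p l + q l * Complex.I) (theta m) k))
    (h₁ : ∀ k, IsIntegral ℤ (rotatedCubic (fun l => p l - q l * Complex.I) (theta m) k))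
    (l : Fin 4) : ∃ P Q : ℤ, 8 * m * (p l + q l * Complex.I) = P + Q * Complex.I := by
  have isInt {r : Fin 4 → ℚ}
      (hr : ∀ k, IsIntegral ℤ (rotatedCubic (fun l => 2 * (r l : ℂ)) (theta m) k)) :
      ∃ n : ℤ, 8 * m * (r l : ℂ) = n := by
    have := (isIntegral_mul_pow_of_rotatedCubic hr l).mul ((isIntegral_theta m).pow (4 - l))
    rw [mul_assoc, ← pow_add, Nat.add_sub_of_le l.is_lt.le, theta_pow_four] at this
    have e : ((8 * m * r l : ℚ) : ℂ) = 4 * (2 * (r l : ℂ)) * m := by push_cast; ring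
    obtain ⟨n, hn⟩ := isIntegral_ratCast_iff.1 (e ▸ this)
    exact ⟨n, by exact_mod_cast congrArg (Rat.cast : ℚ → ℂ) hn⟩
  obtain ⟨P, hP⟩ := isInt (r := p) fun k => by
    have e : rotatedCubic (fun l => 2 * (p l : ℂ)) (theta m) k =
        rotatedCubic (fun l => p l + q l * Complex.I) (theta m) k +
          rotatedCubic (fun l => p l - q l * Complex.I) (theta m) k := by
      rw [rotatedCubic, rotatedCubic, rotatedCubic, ← Finset.sum_add_distrib]
      exact Finset.sum_congr rfl fun l _ => by ring
    exact e ▸ (h₀ k).add (h₁ k)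
  obtain ⟨Q, hQ⟩ := isInt (r := q) fun k => by
    have e : rotatedCubic (fun l => 2 * (q l : ℂ)) (theta m) k =
        -Complex.I * (rotatedCubic (fun l => p l + q l * Complex.I) (theta m) k -
          rotatedCubic (fun l => p l - q l * Complex.I) (theta m) k) := by
      rw [rotatedCubic, rotatedCubic, rotatedCubic, ← Finset.sum_sub_distrib, Finset.mul_sum]
      refine Finset.sum_congr rfl fun l _ => ?_
      linear_combination (2 * q l * (Complex.I ^ k * theta m) ^ (l : ℕ)) * Complex.I_sq
    exact e ▸ Complex.isIntegral_int_I.neg.mul ((h₀ k).sub (h₁ k))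
  exact ⟨P, Q, by rw [← hP, ← hQ]; ring⟩

theorem QuarticRelations.map {R S : Type*} [CommRing R] [CommRing S] {t : ℤ} {i θ η ω : R}
    (h : QuarticRelations t i θ η ω) (f : R →+* S) :
    QuarticRelations t (f i) (f θ) (f η) (f ω) where
  i_sq := by simpa using congrArg f h.i_sq
  eta := by simpa using congrArg f h.eta
  omega := by simpa using congrArg f h.omega
  eta_sq := by simpa [map_ofNat f 2] using congrArg f h.eta_sq

theorem QuarticRelations.map_conjugates {R S : Type*} [CommRing R] [CommRing S] (f : R →+* S)
    (i θ η ω : R) (x y : Fin 4 → R) (j : Fin 2) (k : Fin 4) :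
    f (conjugates i θ η ω x y j k) =
      conjugates (f i) (f θ) (f η) (f ω) (fun l => f (x l)) (fun l => f (y l)) j k := by
  fin_cases j <;> fin_cases k <;> simp [conjugates]

theorem QuarticRelations.exists_conjugates_eq_rotatedCubic {t : ℤ} {θ η ω : ℂ}
    (h : QuarticRelations t Complex.I θ η ω) (a b : Fin 4 → ℤ) :
    ∃ p q : Fin 4 → ℚ, ∀ j k, conjugates Complex.I θ η ω (fun l => a l + b l * Complex.I)
      (fun l => a l - b l * Complex.I) j k =
        rotatedCubic (fun l => p l + (-1) ^ (j : ℕ) * q l * Complex.I) θ k := by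
  have hI := Complex.I_sq
  obtain rfl : η = θ ^ 2 * (1 - Complex.I) / 2 := by
    linear_combination (1 - Complex.I) / 2 * h.eta + η / 2 * hI
  obtain rfl : ω = -Complex.I * θ ^ 3 / 2 + θ * (1 - Complex.I) / 2 := by
    linear_combination (1 - Complex.I) / 2 * h.omega + (ω / 2 + θ ^ 3 / 4) * hI
  refine ⟨![a 0, a 2 + (a 3 + b 3) / 2, (a 1 + b 1) / 2, b 3 / 2],
    ![b 0, b 2 + (b 3 - a 3) / 2, (b 1 - a 1) / 2, -a 3 / 2], fun j k => ?_⟩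
  have hI3 := Complex.I_pow_three
  fin_cases j <;> fin_cases k <;>
    simp [conjugates, rotatedCubic_zero, rotatedCubic_one, rotatedCubic_two, rotatedCubic_three]
      <;> ring_nf <;> simp only [hI, hI3] <;> ring

theorem isIntegral_conjs {m : ℕ} (σ : Fin 2 → Fin 4 → (Kfield m →ₐ[ℚ] ℂ)) (α : 𝓞 (Kfield m))
    (j : Fin 2) (k : Fin 4) : IsIntegral ℤ (conjs m σ α j k) :=
  α.2.map (σ j k : Kfield m →+* ℂ).toIntAlgHom

theorem isIntegral_val_ringOfIntegers {m : ℕ} (α : 𝓞 (Kfield m)) :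
    IsIntegral ℤ ((algebraMap (𝓞 (Kfield m)) (Kfield m) α : Kfield m) : ℂ) :=
  α.2.map (algebraMap (Kfield m) ℂ).toIntAlgHom

/-- The conjugates of an algebraic integer of `K` in terms of its integral coordinates. -/
theorem exists_conjs_eq {m : ℕ} {t : ℤ} (hm : (m : ℤ) = 2 * (2 * t + 1))
    (hsq : Squarefree (2 * t + 1)) {σ : Fin 2 → Fin 4 → (Kfield m →ₐ[ℚ] ℂ)}
    (hσI : ∀ (j : Fin 2) (k : Fin 4) (x : Kfield m),
      (x : ℂ) = Complex.I → σ j k x = (-1 : ℂ) ^ (j : ℕ) * Complex.I)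
    (hσθ : ∀ (j : Fin 2) (k : Fin 4) (x : Kfield m),
      (x : ℂ) = theta m → σ j k x = Complex.I ^ (k : ℕ) * theta m)
    {i θ η ω : integralClosure ℤ ℂ} (h : QuarticRelations t i θ η ω)
    (hI : (i : ℂ) = Complex.I) (hθ : (θ : ℂ) = theta m) (α : 𝓞 (Kfield m)) :
    (∃ p q : Fin 4 → ℚ, ∀ j k, conjs m σ α j k =
      rotatedCubic (fun l => p l + (-1) ^ (j : ℕ) * q l * Complex.I) (theta m) k) ∧
    ∃ a b : Fin 4 → ℤ, ∀ j k, conjs m σ α j k =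
      QuarticRelations.conjugates i θ η ω (fun l => a l + b l * i) (fun l => a l - b l * i) j k := by
  obtain ⟨p, q, hpq⟩ := exists_coordinates (algebraMap (𝓞 (Kfield m)) (Kfield m) α)
  have hconj (j k) := algHom_eq_rotatedCubic (σ j k) (hσI j k) (hσθ j k) hpq
  refine ⟨⟨p, q, hconj⟩, ?_⟩
  have hint (j : Fin 2) (k : ℕ) : IsIntegral ℤ
      (rotatedCubic (fun l => p l + (-1) ^ (j : ℕ) * q l * Complex.I) (theta m) k) := by
    induction k using Nat.strong_induction_on with
    | _ k ih =>
      rcases lt_or_ge k 4 with hk | hk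
      · have := isIntegral_conjs σ α j ⟨k, hk⟩
        rwa [conjs, hconj] at this
      · obtain ⟨n, rfl⟩ := Nat.exists_eq_add_of_le' hk
        rw [rotatedCubic_add_four]
        exact ih n (by omega)
  choose P Q hPQ using exists_intCast_coordinates (p := p) (q := q) (m := m)
    (fun k => by simpa using hint 0 k) (fun k => by simpa [sub_eq_add_neg] using hint 1 k)
  let z : integralClosure ℤ ℂ := ⟨_, isIntegral_val_ringOfIntegers α⟩
  have hz : (z : ℂ) = rotatedCubic (fun l => p l + q l * Complex.I) (theta m) 0 := hpq
  have hmC : (m : ℂ) = 2 * (2 * t + 1) := by exact_mod_cast congrArg (Int.cast : ℤ → ℂ) hm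
  obtain ⟨x₀, h₀, x₁, h₁, x₂, h₂, x₃, h₃, hx⟩ := h.mem_lattice hI hsq (z := z)
    (c := fun l => P l + Q l * i) (fun l => mem_gaussianSubring.2 ⟨P l, Q l, rfl⟩) (by
      apply Subtype.ext
      rw [rotatedCubic_zero] at hz
      push_cast
      rw [hz, hI, hθ, coe_ofNat_integralClosure, coe_ofNat_integralClosure]
      simp only [← hPQ, hmC]
      ring)
  obtain ⟨a₀, b₀, rfl⟩ := mem_gaussianSubring.1 h₀
  obtain ⟨a₁, b₁, rfl⟩ := mem_gaussianSubring.1 h₁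
  obtain ⟨a₂, b₂, rfl⟩ := mem_gaussianSubring.1 h₂
  obtain ⟨a₃, b₃, rfl⟩ := mem_gaussianSubring.1 h₃
  refine ⟨![a₀, a₁, a₂, a₃], ![b₀, b₁, b₂, b₃], fun j k => ?_⟩
  have hC := h.map (algebraMap (integralClosure ℤ ℂ) ℂ)
  have hI' : algebraMap (integralClosure ℤ ℂ) ℂ i = Complex.I := hI
  have hθ' : algebraMap (integralClosure ℤ ℂ) ℂ θ = theta m := hθ
  rw [hI', hθ'] at hC
  obtain ⟨p', q', hpq'⟩ := hC.exists_conjugates_eq_rotatedCubic ![a₀, a₁, a₂, a₃] ![b₀, b₁, b₂, b₃]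
  have hmap (j : Fin 2) (k : Fin 4) := QuarticRelations.map_conjugates
    (algebraMap (integralClosure ℤ ℂ) ℂ) i θ η ω
    (fun l => ![a₀, a₁, a₂, a₃] l + ![b₀, b₁, b₂, b₃] l * i)
    (fun l => ![a₀, a₁, a₂, a₃] l - ![b₀, b₁, b₂, b₃] l * i) j k
  simp only [map_add, map_sub, map_mul, map_intCast, hI', hθ', hpq'] at hmap
  have hx' : z = QuarticRelations.conjugates i θ η ω
      (fun l => ![a₀, a₁, a₂, a₃] l + ![b₀, b₁, b₂, b₃] l * i)
      (fun l => ![a₀, a₁, a₂, a₃] l - ![b₀, b₁, b₂, b₃] l * i) 0 0 := hx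
  have hα : ((algebraMap (𝓞 (Kfield m)) (Kfield m) α : Kfield m) : ℂ) =
      rotatedCubic (fun l => p' l + q' l * Complex.I) (theta m) 0 := by
    have := (congrArg (algebraMap (integralClosure ℤ ℂ) ℂ) hx').trans (hmap 0 0)
    simpa using this
  exact (algHom_eq_rotatedCubic (σ j k) (hσI j k) (hσθ j k) hα).trans (hmap j k).symm

theorem star_rotatedCubic {θ : ℂ} (hθ : star θ = θ) (c : Fin 4 → ℂ) (k : ℕ) :
    star (rotatedCubic c θ k) = rotatedCubic (fun l => star (c l)) θ (3 * k) := by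
  have hI : star Complex.I = Complex.I ^ 3 := by
    rw [Complex.I_pow_three]
    exact Complex.conj_I
  simp only [rotatedCubic, star_sum, star_mul', star_pow, hI, hθ, pow_mul]

section Rationality

variable {a : Fin 2 → Fin 4 → ℂ} {c : Fin 2 → Fin 4 → ℂ} {θ : ℂ}

theorem prod_sub_add_mem_adjoin_I (hθ : θ ^ 4 ∈ Algebra.adjoin ℚ {Complex.I})
    {c d : Fin 4 → ℂ} (hc : ∀ l, c l ∈ Algebra.adjoin ℚ {Complex.I})
    (hd : ∀ l, d l ∈ Algebra.adjoin ℚ {Complex.I}) (s : ℕ) :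
    (rotatedCubic c θ 0 - rotatedCubic d θ (0 + s)) *
      (rotatedCubic c θ 1 - rotatedCubic d θ (1 + s)) *
      (rotatedCubic c θ 2 - rotatedCubic d θ (2 + s)) *
      (rotatedCubic c θ 3 - rotatedCubic d θ (3 + s)) ∈ Algebra.adjoin ℚ {Complex.I} := by
  simp only [rotatedCubic_sub_add]
  exact prod_rotatedCubic_mem (fun l => sub_mem (hc l)
    (mul_mem (pow_mem (Algebra.self_mem_adjoin_singleton ℚ _) _) (hd l))) hθ

theorem symmetric_products_mem_adjoin_I (hθ : θ ^ 4 ∈ Algebra.adjoin ℚ {Complex.I})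
    (hc : ∀ j l, c j l ∈ Algebra.adjoin ℚ {Complex.I})
    (ha : ∀ j k, a j k = rotatedCubic (c j) θ (k : ℕ)) :
    S1 a ∈ Algebra.adjoin ℚ {Complex.I} ∧ S2 a ∈ Algebra.adjoin ℚ {Complex.I} ∧
    S3 a ∈ Algebra.adjoin ℚ {Complex.I} ∧ S4 a ∈ Algebra.adjoin ℚ {Complex.I} ∧
    S5 a ∈ Algebra.adjoin ℚ {Complex.I} ∧ S6 a ∈ Algebra.adjoin ℚ {Complex.I} := by
  have shift (j j' : Fin 2) (s : ℕ) := prod_sub_add_mem_adjoin_I hθ (hc j) (hc j') s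
  have h₀ (j) : a j 0 = rotatedCubic (c j) θ 0 := ha j 0
  have h₁ (j) : a j 1 = rotatedCubic (c j) θ 1 := ha j 1
  have h₂ (j) : a j 2 = rotatedCubic (c j) θ 2 := ha j 2
  have h₃ (j) : a j 3 = rotatedCubic (c j) θ 3 := ha j 3
  have r₄ (d) : rotatedCubic d θ 4 = rotatedCubic d θ 0 := rotatedCubic_add_four d θ 0
  have r₅ (d) : rotatedCubic d θ 5 = rotatedCubic d θ 1 := rotatedCubic_add_four d θ 1
  have r₆ (d) : rotatedCubic d θ 6 = rotatedCubic d θ 2 := rotatedCubic_add_four d θ 2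
  refine ⟨?_, ?_, ?_, ?_, ?_, ?_⟩
  · refine prod_mem fun j _ => ?_
    simpa [h₀, h₁, h₂, h₃, r₄] using shift j j 1
  · have e (j) : (a j 0 - a j 2) * (a j 1 - a j 3) =
        4 * Complex.I * θ ^ 2 * (c j 1 ^ 2 - c j 3 ^ 2 * θ ^ 4) := by
      rw [h₀, h₁, h₂, h₃, rotatedCubic_zero, rotatedCubic_one, rotatedCubic_two,
        rotatedCubic_three]
      ring
    have e' : S2 a = -16 * θ ^ 4 * ∏ j, (c j 1 ^ 2 - c j 3 ^ 2 * θ ^ 4) := by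
      rw [S2, Fin.prod_univ_two, Fin.prod_univ_two, e, e]
      linear_combination 16 * θ ^ 4 * (c 0 1 ^ 2 - c 0 3 ^ 2 * θ ^ 4) *
        (c 1 1 ^ 2 - c 1 3 ^ 2 * θ ^ 4) * Complex.I_sq
    rw [e']
    exact mul_mem (mul_mem (neg_mem (ofNat_mem _ 16)) hθ) (prod_mem fun j _ =>
      sub_mem (pow_mem (hc j 1) 2) (mul_mem (pow_mem (hc j 3) 2) hθ))
  · simpa [S3, h₀, h₁, h₂, h₃] using shift 0 1 0
  · simpa [S4, h₀, h₁, h₂, h₃, r₄, r₅, r₆] using shift 0 1 3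
  · simpa [S5, h₀, h₁, h₂, h₃, r₄, r₅] using shift 0 1 2
  · simpa [S6, h₀, h₁, h₂, h₃, r₄] using shift 0 1 1

theorem star_symmetric_products (ha : ∀ j k, star (a j k) = a (1 - j) (-k)) :
    star (S1 a) = S1 a ∧ star (S2 a) = S2 a ∧ star (S3 a) = S3 a ∧
    star (S4 a) = S4 a ∧ star (S5 a) = S5 a ∧ star (S6 a) = S6 a := by
  have h₀₀ : star (a 0 0) = a 1 0 := ha 0 0
  have h₀₁ : star (a 0 1) = a 1 3 := ha 0 1
  have h₀₂ : star (a 0 2) = a 1 2 := ha 0 2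
  have h₀₃ : star (a 0 3) = a 1 1 := ha 0 3
  have h₁₀ : star (a 1 0) = a 0 0 := ha 1 0
  have h₁₁ : star (a 1 1) = a 0 3 := ha 1 1
  have h₁₂ : star (a 1 2) = a 0 2 := ha 1 2
  have h₁₃ : star (a 1 3) = a 0 1 := ha 1 3
  refine ⟨?_, ?_, ?_, ?_, ?_, ?_⟩ <;>
    simp only [S1, S2, S3, S4, S5, S6, Fin.prod_univ_two, star_mul', star_sub, h₀₀, h₀₁, h₀₂,
      h₀₃, h₁₀, h₁₁, h₁₂, h₁₃] <;> ring

theorem isIntegral_symmetric_products (ha : ∀ j k, IsIntegral ℤ (a j k)) :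
    IsIntegral ℤ (S1 a) ∧ IsIntegral ℤ (S2 a) ∧ IsIntegral ℤ (S3 a) ∧
    IsIntegral ℤ (S4 a) ∧ IsIntegral ℤ (S5 a) ∧ IsIntegral ℤ (S6 a) := by
  have h (j k j' k') : IsIntegral ℤ (a j k - a j' k') := (ha j k).sub (ha j' k')
  refine ⟨?_, ?_, ?_, ?_, ?_, ?_⟩
  · exact .prod _ fun j _ =>
      (((h j 0 j 1).mul (h j 1 j 2)).mul (h j 2 j 3)).mul (h j 3 j 0)
  · exact .prod _ fun j _ => (h j 0 j 2).mul (h j 1 j 3)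
  · exact (((h 0 0 1 0).mul (h 0 1 1 1)).mul (h 0 2 1 2)).mul (h 0 3 1 3)
  · exact (((h 0 0 1 3).mul (h 0 1 1 0)).mul (h 0 2 1 1)).mul (h 0 3 1 2)
  · exact (((h 0 0 1 2).mul (h 0 1 1 3)).mul (h 0 2 1 0)).mul (h 0 3 1 1)
  · exact (((h 0 0 1 1).mul (h 0 1 1 2)).mul (h 0 2 1 3)).mul (h 0 3 1 0)

theorem exists_intCast_eq_symmetric_products (hint : ∀ j k, IsIntegral ℤ (a j k)) {m : ℕ}
    {p q : Fin 4 → ℚ} (ha : ∀ (j : Fin 2) (k : Fin 4), a j k =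
      rotatedCubic (fun l => p l + (-1) ^ (j : ℕ) * q l * Complex.I) (theta m) (k : ℕ)) :
    (∃ s : ℤ, S1 a = s) ∧ (∃ s : ℤ, S2 a = s) ∧ (∃ s : ℤ, S3 a = s) ∧
    (∃ s : ℤ, S4 a = s) ∧ (∃ s : ℤ, S5 a = s) ∧ (∃ s : ℤ, S6 a = s) := by
  obtain ⟨i₁, i₂, i₃, i₄, i₅, i₆⟩ := isIntegral_symmetric_products hint
  obtain ⟨r₁, r₂, r₃, r₄, r₅, r₆⟩ := symmetric_products_mem_adjoin_I
    (c := fun j l => p l + (-1) ^ (j : ℕ) * q l * Complex.I) (θ := theta m)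
    (by rw [theta_pow_four]; exact natCast_mem _ m)
    (fun j l => mem_adjoin_I.2 ⟨p l, (-1) ^ (j : ℕ) * q l, by push_cast; ring⟩) ha
  have hstar (j : Fin 2) (k : Fin 4) : star (a j k) = a (1 - j) (-k) := by
    have hI : star Complex.I = -Complex.I := Complex.conj_I
    have hQ (r : ℚ) : star (r : ℂ) = r := star_ratCast r
    rw [ha, ha, star_rotatedCubic (star_theta m)]
    have hmod (n : ℕ) (c) : rotatedCubic c (theta m) n = rotatedCubic c (theta m) (n % 4) := by
      conv_lhs => rw [← Nat.mod_add_div n 4]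
      simp [rotatedCubic, pow_add, pow_mul]
    rw [hmod (3 * k), hmod ((-k : Fin 4) : ℕ)]
    have hk : ∀ k : Fin 4, 3 * (k : ℕ) % 4 = ((-k : Fin 4) : ℕ) % 4 := by decide
    rw [hk]
    congr 1
    funext l
    simp only [star_add, star_mul', star_pow, star_neg, star_one, hI, hQ]
    fin_cases j <;> simp
  obtain ⟨t₁, t₂, t₃, t₄, t₅, t₆⟩ := star_symmetric_products hstar
  exact ⟨exists_intCast_eq_of_star_eq i₁ r₁ t₁, exists_intCast_eq_of_star_eq i₂ r₂ t₂,
    exists_intCast_eq_of_star_eq i₃ r₃ t₃, exists_intCast_eq_of_star_eq i₄ r₄ t₄,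
    exists_intCast_eq_of_star_eq i₅ r₅ t₅, exists_intCast_eq_of_star_eq i₆ r₆ t₆⟩

end Rationality

section Divisibility

variable {R : Type*} [CommRing R] {A : Fin 2 → Fin 4 → R} {d : R}

theorem pow_dvd_prod_sub_succ
    (hd : ∀ j k, d ∣ A j k - A j (k + 1)) :
    d ^ 8 ∣ ∏ j : Fin 2,
      ((A j 0 - A j 1) * (A j 1 - A j 2) * (A j 2 - A j 3) * (A j 3 - A j 0)) := by
  have key (j : Fin 2) :
      d * d * d * d ∣ (A j 0 - A j 1) * (A j 1 - A j 2) * (A j 2 - A j 3) * (A j 3 - A j 0) :=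
    mul_dvd_mul (mul_dvd_mul (mul_dvd_mul (hd j 0) (hd j 1)) (hd j 2)) (hd j 3)
  rw [Fin.prod_univ_two]
  exact (Eq.dvd (by ring)).trans (mul_dvd_mul (key 0) (key 1))

theorem pow_dvd_prod_sub_add_two
    (hd : ∀ j k, d ∣ A j k - A j (k + 2)) :
    d ^ 4 ∣ ∏ j : Fin 2, ((A j 0 - A j 2) * (A j 1 - A j 3)) := by
  have key (j : Fin 2) : d * d ∣ (A j 0 - A j 2) * (A j 1 - A j 3) :=
    mul_dvd_mul (hd j 0) (hd j 1)
  rw [Fin.prod_univ_two]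
  exact (Eq.dvd (by ring)).trans (mul_dvd_mul (key 0) (key 1))

end Divisibility

/-- Case `m ≡ 2 (mod 4)`: the `Sᵢ` are rational integers; `4m² ∣ S₁`, `8m ∣ S₂`,
and `2` divides `S₃, S₄, S₅, S₆`. -/
theorem stmt_16 (m : ℕ) (hm : Squarefree m) (hpos : 0 < m) (h2 : m % 4 = 2)
    (σ : Fin 2 → Fin 4 → (Kfield m →ₐ[ℚ] ℂ))
    (hσI : ∀ (j : Fin 2) (k : Fin 4) (x : Kfield m),
      (x : ℂ) = Complex.I → σ j k x = (-1 : ℂ) ^ (j : ℕ) * Complex.I)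
    (hσθ : ∀ (j : Fin 2) (k : Fin 4) (x : Kfield m),
      (x : ℂ) = theta m → σ j k x = Complex.I ^ (k : ℕ) * theta m)
    (α : 𝓞 (Kfield m)) :
    ∃ s₁ s₂ s₃ s₄ s₅ s₆ : ℤ,
      S1 (conjs m σ α) = (s₁ : ℂ) ∧ S2 (conjs m σ α) = (s₂ : ℂ) ∧
      S3 (conjs m σ α) = (s₃ : ℂ) ∧ S4 (conjs m σ α) = (s₄ : ℂ) ∧
      S5 (conjs m σ α) = (s₅ : ℂ) ∧ S6 (conjs m σ α) = (s₆ : ℂ) ∧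
      (4 * (m : ℤ) ^ 2) ∣ s₁ ∧ (8 * (m : ℤ)) ∣ s₂ ∧
      (2 : ℤ) ∣ s₃ ∧ (2 : ℤ) ∣ s₄ ∧ (2 : ℤ) ∣ s₅ ∧ (2 : ℤ) ∣ s₆ := by
  obtain ⟨t, hu⟩ : ∃ t : ℤ, (m : ℤ) = 2 * (2 * t + 1) := ⟨m / 4, by omega⟩
  have hsq : Squarefree (2 * t + 1) :=
    (Int.squarefree_natCast.2 hm).squarefree_of_dvd ⟨2, by rw [hu]; ring⟩
  obtain ⟨i, θ, η, ω, h, hI, hθ⟩ := exists_quarticRelations hu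
  obtain ⟨⟨p, q, hpq⟩, a, b, hab⟩ := exists_conjs_eq hu hsq hσI hσθ h hI hθ α
  obtain ⟨⟨s₁, hs₁⟩, ⟨s₂, hs₂⟩, ⟨s₃, hs₃⟩, ⟨s₄, hs₄⟩, ⟨s₅, hs₅⟩, ⟨s₆, hs₆⟩⟩ :=
    exists_intCast_eq_symmetric_products (isIntegral_conjs σ α) hpq
  refine ⟨s₁, s₂, s₃, s₄, s₅, s₆, hs₁, hs₂, hs₃, hs₄, hs₅, hs₆, ?_⟩
  obtain ⟨A, hA⟩ : ∃ A, A = QuarticRelations.conjugates i θ η ω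
    (fun l => a l + b l * i) (fun l => a l - b l * i) := ⟨_, rfl⟩
  simp only [← hA] at hab
  have hsucc := h.conjugates_sub_succ_mem (fun l => a l + b l * i) (fun l => a l - b l * i)
  have htwo := h.conjugates_sub_add_two_mem (fun l => a l + b l * i) (fun l => a l - b l * i)
  have hrad := h.conjugates_sub_mem (Ideal.radical_isRadical _) (one_add_mem_radical h.i_sq)
    a b (fun _ => rfl) (fun _ => rfl)
  simp only [← hA, Ideal.mem_inf, Ideal.mem_span_singleton] at hsucc htwo hrad
  have hθ4 : θ ^ 4 = ((2 * (2 * t + 1) : ℤ) : integralClosure ℤ ℂ) := by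
    rw [h.theta_pow_four]
    push_cast
    rfl
  have e₁ : ∏ j : Fin 2, ((A j 0 - A j 1) * (A j 1 - A j 2) * (A j 2 - A j 3) * (A j 3 - A j 0)) =
      s₁ := by
    refine Subtype.ext ?_
    simpa [S1, hab, Fin.prod_univ_two] using hs₁
  have e₂ : ∏ j : Fin 2, ((A j 0 - A j 2) * (A j 1 - A j 3)) = s₂ := by
    refine Subtype.ext ?_
    simpa [S2, hab, Fin.prod_univ_two] using hs₂
  have even {k₀ k₁ k₂ k₃ : Fin 4} {s : ℤ} (hs : (A 0 0 - A 1 k₀ : ℂ) * (A 0 1 - A 1 k₁) *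
      (A 0 2 - A 1 k₂) * (A 0 3 - A 1 k₃) = s) : 2 ∣ s := by
    refine dvd_of_mem_radical_integralClosure Int.prime_two.squarefree ?_
    have e : (A 0 0 - A 1 k₀) * (A 0 1 - A 1 k₁) * (A 0 2 - A 1 k₂) * (A 0 3 - A 1 k₃) = s :=
      Subtype.ext (by simpa using hs)
    exact e ▸ Ideal.mul_mem_left _ _ (hrad 3 k₃)
  have hcop : IsCoprime (16 : ℤ) (2 * t + 1) :=
    IsCoprime.pow_left (m := 4) (x := 2) (y := 2 * t + 1) ⟨-t, 1, by ring⟩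
  rw [hu]
  refine ⟨?_, ?_, even (by simpa only [S3, hab] using hs₃), even (by simpa only [S4, hab] using hs₄),
    even (by simpa only [S5, hab] using hs₅), even (by simpa only [S6, hab] using hs₆)⟩
  · have hπ : (1 + i) ^ 8 = 16 := by
      have e : (1 + i) ^ 2 = 2 * i := by linear_combination h.i_sq
      calc (1 + i) ^ 8 = ((1 + i) ^ 2) ^ 4 := by ring
        _ = 16 * (i ^ 2) ^ 2 := by rw [e]; ring
        _ = 16 := by rw [h.i_sq]; ring
    have d₁ : (16 : ℤ) ∣ s₁ := intCast_dvd_intCast_integralClosure <| e₁ ▸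
      (Eq.dvd (by push_cast; rw [hπ])).trans
        (pow_dvd_prod_sub_succ fun j k => (hsucc j k).1)
    have d₂ : (2 * (2 * t + 1)) ^ 2 ∣ s₁ := intCast_dvd_intCast_integralClosure <| e₁ ▸
      (Eq.dvd (by push_cast at hθ4 ⊢; rw [← hθ4]; ring)).trans
        (pow_dvd_prod_sub_succ fun j k => (hsucc j k).2)
    refine (Eq.dvd (by ring)).trans ((hcop.pow_right (n := 2)).mul_dvd d₁
      ((Dvd.intro_left (2 ^ 2) (by ring)).trans d₂))
  · have d₁ : (16 : ℤ) ∣ s₂ := intCast_dvd_intCast_integralClosure <| e₂ ▸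
      (Eq.dvd (by push_cast; norm_num)).trans
        (pow_dvd_prod_sub_add_two fun j k => (htwo j k).1)
    have d₂ : 2 * (2 * t + 1) ∣ s₂ := intCast_dvd_intCast_integralClosure <| e₂ ▸
      hθ4.symm.dvd.trans (pow_dvd_prod_sub_add_two fun j k => (htwo j k).2)
    exact (Eq.dvd (by ring)).trans (hcop.mul_dvd d₁ ((Dvd.intro_left 2 rfl).trans d₂))
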